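/- B^{m,i} satisfies the dual Stembridge axioms: for every A ∈ B^{m,i} and l, j ∈ {1,…,n} with j ≠ l such that f_l A ≠ 0 and f_j A ≠ 0: (a) if φ_j(f_l A) = φ_j(A) then f_l f_j A = f_j f_l A ≠ 0 and, with A' = f_l f_j A, ε_l(A') = ε_l(e_j A'); (b) if φ_j(A) − φ_j(f_l A) = φ_l(A) − φ_l(f_j A) = −1, then f_l f_j f_j f_l A = f_j f_l f_l f_j A ≠ 0 and, with A' this common element, ε_l(A') − ε_l(e_j A') = ε_j(A') − ε_j(e_l A') = −1. -/

import Mathlib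

open Finset

namespace KR

/-- Arrays of integers indexed by (column, row). -/
abbrev Arr := ℕ → ℕ → ℤ

/-- A Dyck path from (1,i) to (i,n). -/
def IsDyck (n i : ℕ) (L : List (ℕ × ℕ)) : Prop :=
  L ≠ [] ∧ L.head? = some (1, i) ∧ L.getLast? = some (i, n) ∧
    L.Chain' (fun β γ => γ = (β.1, β.2 + 1) ∨ γ = (β.1 + 1, β.2))

/-- Membership in the polytope `B^{m,i}`: nonnegative entries supported on the box
`1 ≤ p ≤ i`, `i ≤ q ≤ n`, with all Dyck path sums bounded by `m`. -/
def InB (n i m : ℕ) (A : Arr) : Prop :=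
  (∀ p q, 1 ≤ p → p ≤ i → i ≤ q → q ≤ n → 0 ≤ A p q) ∧
  (∀ p q, ¬(1 ≤ p ∧ p ≤ i ∧ i ≤ q ∧ q ≤ n) → A p q = 0) ∧
  (∀ L, IsDyck n i L → (L.map fun β => A β.1 β.2).sum ≤ (m : ℤ))

/-- The sum `Σ_{j=1}^{p} a_{j,l−1} + Σ_{j=p}^{i} a_{j,l}` (used for `l > i`). -/
def Fp (i : ℕ) (A : Arr) (l p : ℕ) : ℤ :=
  ∑ j ∈ Icc 1 p, A j (l - 1) + ∑ j ∈ Icc p i, A j l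

/-- `p_+^l(A)`: minimal maximizer of `Fp` on `{1,…,i}`. -/
noncomputable def pplus (i : ℕ) (A : Arr) (l : ℕ) : ℕ :=
  sInf {p | p ∈ Icc 1 i ∧ ∀ q ∈ Icc 1 i, Fp i A l q ≤ Fp i A l p}

/-- `q_+^l(A)`: maximal maximizer of `Fp` on `{1,…,i}`. -/
noncomputable def qplus (i : ℕ) (A : Arr) (l : ℕ) : ℕ :=
  sSup {p | p ∈ Icc 1 i ∧ ∀ q ∈ Icc 1 i, Fp i A l q ≤ Fp i A l p}

/-- The sum `Σ_{j=i}^{p} a_{l,j} + Σ_{j=p}^{n} a_{l+1,j}` (used for `l < i`). -/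
def Fm (n i : ℕ) (A : Arr) (l p : ℕ) : ℤ :=
  ∑ j ∈ Icc i p, A l j + ∑ j ∈ Icc p n, A (l + 1) j

/-- `p_−^l(A)`: maximal maximizer of `Fm` on `{i,…,n}`. -/
noncomputable def pminus (n i : ℕ) (A : Arr) (l : ℕ) : ℕ :=
  sSup {p | p ∈ Icc i n ∧ ∀ q ∈ Icc i n, Fm n i A l q ≤ Fm n i A l p}

/-- `q_−^l(A)`: minimal maximizer of `Fm` on `{i,…,n}`. -/
noncomputable def qminus (n i : ℕ) (A : Arr) (l : ℕ) : ℕ :=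
  sInf {p | p ∈ Icc i n ∧ ∀ q ∈ Icc i n, Fm n i A l q ≤ Fm n i A l p}

/-- `φ_l(A)` (depending on the parameter `m` only when `l = i`). -/
noncomputable def phi (n i m : ℕ) (l : ℕ) (A : Arr) : ℤ :=
  if l = i then (m : ℤ) - ∑ j ∈ Icc 1 (i - 1), A j i - ∑ j ∈ Icc i n, A i j
  else if i < l then
    ∑ j ∈ Icc 1 (pplus i A l), A j (l - 1) - ∑ j ∈ Icc 1 (pplus i A l - 1), A j l
  else
    ∑ j ∈ Icc (pminus n i A l) n, A (l + 1) j - ∑ j ∈ Icc (pminus n i A l + 1) n, A l j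

/-- `ε_l(A)` (the parameter `m` is carried along for uniformity; it is not used). -/
noncomputable def eps (n i m : ℕ) (l : ℕ) (A : Arr) : ℤ :=
  if l = i then A i i
  else if i < l then
    ∑ j ∈ Icc (qplus i A l) i, A j l - ∑ j ∈ Icc (qplus i A l + 1) i, A j (l - 1)
  else
    ∑ j ∈ Icc i (qminus n i A l), A l j - ∑ j ∈ Icc i (qminus n i A l - 1), A (l + 1) j

/-- Update a single entry of an array. -/
def upd (A : Arr) (p q : ℕ) (v : ℤ) : Arr :=
  fun p' q' => if p' = p ∧ q' = q then v else A p' q'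

/-- The Kashiwara operator `f_l` (with `none` playing the role of `0`). -/
noncomputable def fop (n i m : ℕ) (l : ℕ) (A : Arr) : Option Arr :=
  if phi n i m l A = 0 then none
  else some <|
    if l = i then upd A i i (A i i + 1)
    else if i < l then
      upd (upd A (pplus i A l) (l - 1) (A (pplus i A l) (l - 1) - 1))
        (pplus i A l) l (A (pplus i A l) l + 1)
    else
      upd (upd A l (pminus n i A l) (A l (pminus n i A l) + 1))
        (l + 1) (pminus n i A l) (A (l + 1) (pminus n i A l) - 1)

/-- The Kashiwara operator `e_l` (with `none` playing the role of `0`). -/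
noncomputable def eop (n i m : ℕ) (l : ℕ) (A : Arr) : Option Arr :=
  if eps n i m l A = 0 then none
  else some <|
    if l = i then upd A i i (A i i - 1)
    else if i < l then
      upd (upd A (qplus i A l) (l - 1) (A (qplus i A l) (l - 1) + 1))
        (qplus i A l) l (A (qplus i A l) l - 1)
    else
      upd (upd A l (qminus n i A l) (A l (qminus n i A l) - 1))
        (l + 1) (qminus n i A l) (A (l + 1) (qminus n i A l) + 1)

/-- Coefficient of `ω_j` in the simple root `α_r` (column `r` of the Cartan matrix). -/
def cart (j r : ℕ) : ℤ :=
  if r = j then 2 else if r = j + 1 ∨ j = r + 1 then -1 else 0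

/-- The weight `wt(A) = mω_i − Σ a_{p,q} α_{p,q}`, expressed in the basis of
fundamental weights: `wtv n i m A j` is the coefficient of `ω_j`. -/
def wtv (n i m : ℕ) (A : Arr) (j : ℕ) : ℤ :=
  (m : ℤ) * (if j = i then 1 else 0) -
    ∑ p ∈ Icc 1 i, ∑ q ∈ Icc i n, A p q * ∑ r ∈ Icc p q, cart j r

/-- The coefficient `c_l(p,q)` of the pairing `⟨α_l^∨, α_{p,q}⟩`. -/
def clpq (l p q : ℕ) : ℤ :=
  if p = l ∧ q = l then 2
  else if (l = p ∧ p < q) ∨ (p < q ∧ q = l) then 1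
  else if l + 1 = p ∨ l = q + 1 then -1
  else 0

/-- The pairing `⟨α_l^∨, wt(A)⟩ = m·δ_{l,i} − Σ_{p,q} a_{p,q}·c_l(p,q)`. -/
def pairing (n i m : ℕ) (l : ℕ) (A : Arr) : ℤ :=
  (m : ℤ) * (if l = i then 1 else 0) -
    ∑ p ∈ Icc 1 i, ∑ q ∈ Icc i n, A p q * clpq l p q

/-! ### The promotion algorithm -/

/-- Columns, indexed by rows `i,…,n`. -/
abbrev Col := ℕ → ℤ

/-- `Σ_{j=lo}^{p} a_j + Σ_{j=p}^{n} b_j`. -/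
def Gc (n lo : ℕ) (a b : Col) (p : ℕ) : ℤ := ∑ j ∈ Icc lo p, a j + ∑ j ∈ Icc p n, b j

/-- `q_−` for two (truncated) columns with rows `lo,…,n`: the minimal maximizer of `Gc`. -/
noncomputable def qmc (n lo : ℕ) (a b : Col) : ℕ :=
  if lo ≤ n then
    max lo (sInf {p | p ∈ Icc lo n ∧ ∀ q ∈ Icc lo n, Gc n lo a b q ≤ Gc n lo a b p})
  else n

/-- `ε` for two (truncated) columns with rows `lo,…,n`. -/
noncomputable def epsc (n lo : ℕ) (a b : Col) : ℤ :=
  ∑ j ∈ Icc lo (qmc n lo a b), a j - ∑ j ∈ Icc lo (qmc n lo a b - 1), b j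

/-- The sequence `l_1 < l_2 < ⋯` of the promotion algorithm:
`l_1 = q_−(a,c)` and `l_{s+1} = q_−((a)^{≥ l_s + 1}, (c)^{≥ l_s + 1})`,
stabilizing at `n`. -/
noncomputable def lfun (n i : ℕ) (a c : Col) : ℕ → ℕ
  | 0 => qmc n i a c
  | s + 1 => qmc n (lfun n i a c s + 1) a c

/-- The set `{l_1, …, l_t}` (with `l_t = n`). -/
noncomputable def lset (n i : ℕ) (a c : Col) : Finset ℕ := (Finset.range (n + 1)).image (lfun n i a c)

/-- The new column `ĉ` of formula (6.2). -/
noncomputable def hatc (n i : ℕ) (a c : Col) : Col := fun r =>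
  if r = n then a n + c n
  else if r ∈ lset n i a c then a r + c r - epsc n (r + 1) a c
  else a r

/-- The output column of one step of the promotion algorithm. -/
noncomputable def prcol (n i : ℕ) (a c : Col) : Col := fun r =>
  if r = i then epsc n i a c
  else if r - 1 ∈ lset n i a c then epsc n r a c
  else c (r - 1)

/-- The running columns of the promotion algorithm: `cseq 0` is the `i`-th column of `A`,
and `cseq (k+1)` is obtained from the `(i−1−k)`-th column of `A` and `cseq k`. -/
noncomputable def cseq (n i : ℕ) (A : Arr) : ℕ → Col
  | 0 => fun r => A i r
  | k + 1 => hatc n i (fun r => A (i - 1 - k) r) (cseq n i A k)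

/-- The `j`-th column of `pr(A)` for `2 ≤ j ≤ i`. -/
noncomputable def prColJ (n i : ℕ) (A : Arr) (j : ℕ) : Col :=
  prcol n i (fun q => A (j - 1) q) (cseq n i A (i - j))

/-- The promotion map `pr` on `B^{m,i}`. -/
noncomputable def prMap (n i m : ℕ) (A : Arr) : Arr := fun p r =>
  if 1 ≤ p ∧ p ≤ i ∧ i ≤ r ∧ r ≤ n then
    if p = 1 then
      if r = i then
        (m : ℤ) - (∑ j ∈ Icc i n, A i j) - ∑ j ∈ Icc 2 i, prColJ n i A j i
      else
        (∑ j ∈ Icc 1 i, A j (r - 1)) - ∑ j ∈ Icc 2 i, prColJ n i A j r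
    else prColJ n i A p r
  else 0

/-- The content `(r_1,…,r_{n+1})` of an array. -/
def cont (n i m : ℕ) (A : Arr) (k : ℕ) : ℤ :=
  if k ≤ i then (m : ℤ) - ∑ q ∈ Icc i n, A k q else ∑ p ∈ Icc 1 i, A p (k - 1)

/-- The elementary array with a single entry `1` at `(p, q)`. -/
def unitArr (p q : ℕ) : Arr := fun u v => if u = p ∧ v = q then 1 else 0

/-- The positions among which the operators indexed by `l` choose. -/
def posSet (n i l : ℕ) : Finset ℕ :=
  if l = i then {i} else if i < l then Icc 1 i else Icc i n

/-- The sign-adjusted position, so that `f_l` always acts at the first maximizer. -/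
def key (i l t : ℕ) : ℤ := if l < i then -(t : ℤ) else t

/-- The function of the position whose maximum is `φ_l`. -/
def pot (n i m l : ℕ) (A : Arr) (t : ℕ) : ℤ :=
  if l = i then (m : ℤ) - ∑ j ∈ Icc 1 (i - 1), A j i - ∑ j ∈ Icc i n, A i j
  else if i < l then ∑ j ∈ Icc 1 t, A j (l - 1) - ∑ j ∈ Icc 1 (t - 1), A j l
  else ∑ j ∈ Icc t n, A (l + 1) j - ∑ j ∈ Icc (t + 1) n, A l j

/-- The change of the array when `f_l` acts at position `t`. -/
def move (i l t : ℕ) : Arr :=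
  if l = i then unitArr i i
  else if i < l then unitArr t l - unitArr t (l - 1)
  else unitArr l t - unitArr (l + 1) t

/-- The difference `φ_l - ε_l`. -/
def weight (n i m l : ℕ) (A : Arr) : ℤ :=
  if l = i then (m : ℤ) - ∑ j ∈ Icc 1 (i - 1), A j i - ∑ j ∈ Icc i n, A i j - A i i
  else if i < l then ∑ j ∈ Icc 1 i, A j (l - 1) - ∑ j ∈ Icc 1 i, A j l
  else ∑ j ∈ Icc i n, A (l + 1) j - ∑ j ∈ Icc i n, A l j

/-- `p` is the first maximizer of `P` on `S` with respect to the key `k`. -/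
structure IsFirstMax (k : ℕ → ℤ) (S : Finset ℕ) (P : ℕ → ℤ) (p : ℕ) : Prop where
  mem : p ∈ S
  le : ∀ t ∈ S, P t ≤ P p
  lt : ∀ t ∈ S, k t < k p → P t < P p

lemma exists_isFirstMax (k : ℕ → ℤ) (S : Finset ℕ) (P : ℕ → ℤ) (hS : S.Nonempty) :
    ∃ p, IsFirstMax k S P p := by
  obtain ⟨a, ha, hamax⟩ := S.exists_max_image P hS
  obtain ⟨b, hb, hbmin⟩ := (S.filter fun t => P t = P a).exists_min_image k
    ⟨a, by simp [ha]⟩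
  rw [mem_filter] at hb
  refine ⟨b, hb.1, fun t ht => hb.2 ▸ hamax t ht, fun t ht hlt => ?_⟩
  by_contra hcon
  have h1 := hamax t ht
  have h2 := hbmin t (by rw [mem_filter]; exact ⟨ht, by omega⟩)
  omega

/-- If the potential is raised at the positions from `p` on and its maximum does not change, then
all maximizers lie before `p`. -/
lemma isFirstMax_of_raise_ge {k : ℕ → ℤ} {S T : Finset ℕ} {P Q P₁ Q₁ : ℕ → ℤ} {p q q₁ : ℕ}
    (hp : IsFirstMax k S P p) (hq : IsFirstMax k T Q q) (hq₁ : IsFirstMax k T Q₁ q₁)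
    (hQ₁ : ∀ t ∈ T, Q₁ t = Q t + if k p ≤ k t then 1 else 0)
    (hP₁ : ∀ t ∈ S, P₁ t = P t + if k q < k t then 1 else 0)
    (hval : Q₁ q₁ = Q q) :
    IsFirstMax k T Q₁ q ∧ Q₁ q = Q q ∧ IsFirstMax k S P₁ p ∧ P₁ p = P p + 1 := by
  have hqp : k q < k p := by
    have := hQ₁ q hq.mem
    have := hq₁.le q hq.mem
    split_ifs at * <;> omega
  have hQq : Q₁ q = Q q := by rw [hQ₁ q hq.mem, if_neg (by omega), add_zero]
  have hPp : P₁ p = P p + 1 := by rw [hP₁ p hp.mem, if_pos hqp]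
  refine ⟨⟨hq.mem, fun t ht => ?_, fun t ht hlt => ?_⟩, hQq,
    ⟨hp.mem, fun t ht => ?_, fun t ht hlt => ?_⟩, hPp⟩
  · have := hq₁.le t ht
    omega
  · have := hq.lt t ht hlt
    rw [hQ₁ t ht, if_neg (by omega)]
    omega
  · have := hp.le t ht
    rw [hP₁ t ht]
    split_ifs <;> omega
  · have := hp.lt t ht hlt
    rw [hP₁ t ht]
    split_ifs <;> omega

/-- If the potential is raised at the positions after `q` and its maximum does not change, then
no maximizer lies after `q`. -/
lemma isFirstMax_of_raise_gt {k : ℕ → ℤ} {S T : Finset ℕ} {P Q P₁ Q₁ : ℕ → ℤ} {p q p₁ : ℕ}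
    (hp : IsFirstMax k S P p) (hq : IsFirstMax k T Q q) (hp₁ : IsFirstMax k S P₁ p₁)
    (hQ₁ : ∀ t ∈ T, Q₁ t = Q t + if k p ≤ k t then 1 else 0)
    (hP₁ : ∀ t ∈ S, P₁ t = P t + if k q < k t then 1 else 0)
    (hval : P₁ p₁ = P p) :
    IsFirstMax k T Q₁ q ∧ Q₁ q = Q q + 1 ∧ IsFirstMax k S P₁ p ∧ P₁ p = P p := by
  have hpq : k p ≤ k q := by
    have := hP₁ p hp.mem
    have := hp₁.le p hp.mem
    split_ifs at * <;> omega
  have hQq : Q₁ q = Q q + 1 := by rw [hQ₁ q hq.mem, if_pos hpq]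
  have hPp : P₁ p = P p := by rw [hP₁ p hp.mem, if_neg (by omega), add_zero]
  refine ⟨⟨hq.mem, fun t ht => ?_, fun t ht hlt => ?_⟩, hQq,
    ⟨hp.mem, fun t ht => ?_, fun t ht hlt => ?_⟩, hPp⟩
  · have := hq.le t ht
    rw [hQ₁ t ht]
    split_ifs <;> omega
  · have := hq.lt t ht hlt
    rw [hQ₁ t ht]
    split_ifs <;> omega
  · have := hp₁.le t ht
    omega
  · have := hp.lt t ht hlt
    rw [hP₁ t ht, if_neg (by omega)]
    omega

/-- The two words of length four in the two operators act at the same positions. -/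
lemma quartic_positions {k : ℕ → ℤ} {S T : Finset ℕ} {P Q P₁ Q₁ P₂ Q₂ P₃ Q₃ : ℕ → ℤ}
    {p q p₁ q₁ p₂ q₂ p₃ q₃ : ℕ}
    (hp : IsFirstMax k S P p) (hq : IsFirstMax k T Q q)
    (hp₁ : IsFirstMax k S P₁ p₁) (hq₁ : IsFirstMax k T Q₁ q₁)
    (hp₂ : IsFirstMax k S P₂ p₂) (hq₂ : IsFirstMax k T Q₂ q₂)
    (hp₃ : IsFirstMax k S P₃ p₃) (hq₃ : IsFirstMax k T Q₃ q₃)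
    (hP₁ : ∀ t ∈ S, P₁ t = P t + if k q < k t then 1 else 0)
    (hQ₁ : ∀ t ∈ T, Q₁ t = Q t + if k p ≤ k t then 1 else 0)
    (hP₂ : ∀ t ∈ S, P₂ t =
      P₁ t - (if k p₁ ≤ k t then 1 else 0) - (if k p₁ < k t then 1 else 0))
    (hQ₂ : ∀ t ∈ T, Q₂ t =
      Q₁ t - (if k q₁ ≤ k t then 1 else 0) - (if k q₁ < k t then 1 else 0))
    (hP₃ : ∀ t ∈ S, P₃ t =
      P t - (if k p ≤ k t then 1 else 0) - (if k p < k t then 1 else 0) +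
        (if k q₁ < k t then 1 else 0) + (if k q₂ < k t then 1 else 0))
    (hQ₃ : ∀ t ∈ T, Q₃ t =
      Q t - (if k q ≤ k t then 1 else 0) - (if k q < k t then 1 else 0) +
        (if k p₁ ≤ k t then 1 else 0) + (if k p₂ ≤ k t then 1 else 0))
    (hPval : P₁ p₁ = P p + 1) (hQval : Q₁ q₁ = Q q + 1) :
    (P₂ p₂ = P p ∧ P₃ p₃ = P p ∧ Q₂ q₂ = Q q ∧ Q₃ q₃ = Q q) ∧
      ((k p = k p₂ ∧ k p₁ = k p₃ ∧ k q = k q₁ ∧ k q₂ = k q₃) ∨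
        (k p = k p₁ ∧ k p₂ = k p₃ ∧ k q = k q₂ ∧ k q₁ = k q₃)) := by
  have memp := hp.mem
  have memq := hq.mem
  have memp₁ := hp₁.mem
  have memq₁ := hq₁.mem
  have memp₂ := hp₂.mem
  have memq₂ := hq₂.mem
  have memp₃ := hp₃.mem
  have memq₃ := hq₃.mem
  have hPp₁ := hp.le p₁ memp₁
  have hQq₁ := hq.le q₁ memq₁
  have hp₁q : k q < k p₁ := by
    have := hP₁ p₁ memp₁
    split_ifs at * <;> omega
  have hq₁p : k p ≤ k q₁ := by
    have := hQ₁ q₁ memq₁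
    split_ifs at * <;> omega
  have eP₁ : P p₁ = P p := by
    have := hP₁ p₁ memp₁
    rw [if_pos hp₁q] at this
    omega
  have eQ₁ : Q q₁ = Q q := by
    have := hQ₁ q₁ memq₁
    rw [if_pos hq₁p] at this
    omega
  have hle_p₁ : k p ≤ k p₁ := by
    have := hp.lt p₁ memp₁
    omega
  have hle_q₁ : k q ≤ k q₁ := by
    have := hq.lt q₁ memq₁
    omega
  have first_p₁ : ∀ t ∈ S, k q < k t → k t < k p₁ → P t < P p := by
    intro t ht h1 h2
    have := hp₁.lt t ht h2
    rw [hP₁ t ht, if_pos h1] at this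
    omega
  have first_q₁ : ∀ t ∈ T, k p ≤ k t → k t < k q₁ → Q t < Q q := by
    intro t ht h1 h2
    have := hq₁.lt t ht h2
    rw [hQ₁ t ht, if_pos h1] at this
    omega
  have formP₂ : ∀ t ∈ S, P₂ t = P t + (if k q < k t then 1 else 0) -
      (if k p₁ ≤ k t then 1 else 0) - (if k p₁ < k t then 1 else 0) := fun t ht => by
    rw [hP₂ t ht, hP₁ t ht]
  have formQ₂ : ∀ t ∈ T, Q₂ t = Q t + (if k p ≤ k t then 1 else 0) -
      (if k q₁ ≤ k t then 1 else 0) - (if k q₁ < k t then 1 else 0) := fun t ht => by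
    rw [hQ₂ t ht, hQ₁ t ht]
  clear hP₁ hQ₁ hP₂ hQ₂
  rcases le_or_gt (k p) (k q) with hpq | hqp
  · have kq₁ : k q₁ = k q := by
      have := first_q₁ q memq hpq
      omega
    have kp₂ : k p₂ = k p ∧ P₂ p₂ = P p := by
      have h1 := hp₂.le p memp
      have h2 := hp₂.lt p memp
      have h3 := hp.le p₂ memp₂
      have h4 := hp.lt p₂ memp₂
      have h5 := first_p₁ p₂ memp₂
      rw [formP₂ p memp, formP₂ p₂ memp₂] at h1 h2
      rw [formP₂ p₂ memp₂]
      grind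
    have kq₂ : k p ≤ k q₂ ∧ k q₂ ≤ k q ∧ Q₂ q₂ = Q q := by
      have h1 := hq₂.le q memq
      have h2 := hq₂.lt q memq
      have h3 := hq.le q₂ memq₂
      have h4 := hq.lt q₂ memq₂
      rw [formQ₂ q memq, formQ₂ q₂ memq₂] at h1 h2
      rw [formQ₂ q₂ memq₂]
      grind
    have kp₃ : k p₃ = k p₁ ∧ P₃ p₃ = P p := by
      have h1 := hp₃.le p₁ memp₁
      have h2 := hp₃.lt p₁ memp₁
      have h3 := hp.le p₃ memp₃
      have h4 := hp.lt p₃ memp₃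
      have h5 := first_p₁ p₃ memp₃
      rw [hP₃ p₁ memp₁, hP₃ p₃ memp₃] at h1 h2
      rw [hP₃ p₃ memp₃]
      grind
    have kq₃ : k q₃ = k q₂ ∧ Q₃ q₃ = Q q := by
      have h1 := hq₃.le q₂ memq₂
      have h2 := hq₃.lt q₂ memq₂
      have h3 := hq.le q₃ memq₃
      have h4 := hq.lt q₃ memq₃
      have h5 := hq₂.le q₃ memq₃
      have h6 := hq₂.lt q₃ memq₃
      have h7 := formQ₂ q₂ memq₂
      rw [hQ₃ q₂ memq₂, hQ₃ q₃ memq₃] at h1 h2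
      rw [formQ₂ q₃ memq₃] at h5 h6
      rw [hQ₃ q₃ memq₃]
      grind
    omega
  · have kp₁ : k p₁ = k p := by
      have := first_p₁ p memp hqp
      omega
    have kq₂ : k q₂ = k q ∧ Q₂ q₂ = Q q := by
      have h1 := hq₂.le q memq
      have h2 := hq₂.lt q memq
      have h3 := hq.le q₂ memq₂
      have h4 := hq.lt q₂ memq₂
      have h5 := first_q₁ q₂ memq₂
      rw [formQ₂ q memq, formQ₂ q₂ memq₂] at h1 h2
      rw [formQ₂ q₂ memq₂]
      grind
    have kp₂ : k q < k p₂ ∧ k p₂ ≤ k p ∧ P₂ p₂ = P p := by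
      have h1 := hp₂.le p memp
      have h2 := hp₂.lt p memp
      have h3 := hp.le p₂ memp₂
      have h4 := hp.lt p₂ memp₂
      rw [formP₂ p memp, formP₂ p₂ memp₂] at h1 h2
      rw [formP₂ p₂ memp₂]
      grind
    have kq₃ : k q₃ = k q₁ ∧ Q₃ q₃ = Q q := by
      have h1 := hq₃.le q₁ memq₁
      have h2 := hq₃.lt q₁ memq₁
      have h3 := hq.le q₃ memq₃
      have h4 := hq.lt q₃ memq₃
      have h5 := first_q₁ q₃ memq₃
      rw [hQ₃ q₁ memq₁, hQ₃ q₃ memq₃] at h1 h2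
      rw [hQ₃ q₃ memq₃]
      grind
    have kp₃ : k p₃ = k p₂ ∧ P₃ p₃ = P p := by
      have h1 := hp₃.le p₂ memp₂
      have h2 := hp₃.lt p₂ memp₂
      have h3 := hp.le p₃ memp₃
      have h4 := hp.lt p₃ memp₃
      have h5 := hp₂.le p₃ memp₃
      have h6 := hp₂.lt p₃ memp₃
      have h7 := formP₂ p₂ memp₂
      rw [hP₃ p₂ memp₂, hP₃ p₃ memp₃] at h1 h2
      rw [formP₂ p₃ memp₃] at h5 h6
      rw [hP₃ p₃ memp₃]
      grind
    omega

lemma sum_unitArr_left (a b p q c : ℕ) :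
    ∑ u ∈ Icc a b, unitArr p q u c = if a ≤ p ∧ p ≤ b ∧ c = q then 1 else 0 := by
  by_cases hc : c = q <;> simp [unitArr, hc, Finset.sum_ite_eq', mem_Icc]

lemma sum_unitArr_right (a b p q c : ℕ) :
    ∑ v ∈ Icc a b, unitArr p q c v = if a ≤ q ∧ q ≤ b ∧ c = p then 1 else 0 := by
  by_cases hc : c = p <;> simp [unitArr, hc, Finset.sum_ite_eq', mem_Icc]

lemma move_self (i t : ℕ) : move i i t = unitArr i i := by simp [move]

lemma move_of_gt {i l : ℕ} (h : i < l) (t : ℕ) :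
    move i l t = unitArr t l - unitArr t (l - 1) := by
  simp [move, h, h.ne']

lemma move_of_lt {i l : ℕ} (h : l < i) (t : ℕ) :
    move i l t = unitArr l t - unitArr (l + 1) t := by
  simp [move, h.ne, h.not_gt]

lemma pot_self (n i m : ℕ) (A : Arr) (t : ℕ) :
    pot n i m i A t = (m : ℤ) - ∑ j ∈ Icc 1 (i - 1), A j i - ∑ j ∈ Icc i n, A i j := by
  simp [pot]

lemma pot_of_gt {i l : ℕ} (h : i < l) (n m : ℕ) (A : Arr) (t : ℕ) :
    pot n i m l A t = ∑ j ∈ Icc 1 t, A j (l - 1) - ∑ j ∈ Icc 1 (t - 1), A j l := by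
  simp [pot, h, h.ne']

lemma pot_of_lt {i l : ℕ} (h : l < i) (n m : ℕ) (A : Arr) (t : ℕ) :
    pot n i m l A t = ∑ j ∈ Icc t n, A (l + 1) j - ∑ j ∈ Icc (t + 1) n, A l j := by
  simp [pot, h.ne, h.not_gt]

lemma weight_self (n i m : ℕ) (A : Arr) : weight n i m i A =
    (m : ℤ) - ∑ j ∈ Icc 1 (i - 1), A j i - ∑ j ∈ Icc i n, A i j - A i i := by
  simp [weight]

lemma weight_of_gt {i l : ℕ} (h : i < l) (n m : ℕ) (A : Arr) :
    weight n i m l A = ∑ j ∈ Icc 1 i, A j (l - 1) - ∑ j ∈ Icc 1 i, A j l := by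
  simp [weight, h, h.ne']

lemma weight_of_lt {i l : ℕ} (h : l < i) (n m : ℕ) (A : Arr) :
    weight n i m l A = ∑ j ∈ Icc i n, A (l + 1) j - ∑ j ∈ Icc i n, A l j := by
  simp [weight, h.ne, h.not_gt]

lemma posSet_self (n i : ℕ) : posSet n i i = {i} := by simp [posSet]

lemma posSet_of_gt {i l : ℕ} (h : i < l) (n : ℕ) : posSet n i l = Icc 1 i := by
  simp [posSet, h, h.ne']

lemma posSet_of_lt {i l : ℕ} (h : l < i) (n : ℕ) : posSet n i l = Icc i n := by
  simp [posSet, h.ne, h.not_gt]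

lemma key_of_ge {i l : ℕ} (h : i ≤ l) (t : ℕ) : key i l t = t := by
  simp [key, h.not_gt]

lemma key_of_lt {i l : ℕ} (h : l < i) (t : ℕ) : key i l t = -(t : ℤ) := by
  simp [key, h]

lemma key_injective (i l : ℕ) : Function.Injective (key i l) := by
  intro a b h
  unfold key at h
  split_ifs at h <;> omega

lemma posSet_nonempty {n i : ℕ} (hi : 1 ≤ i) (hin : i ≤ n) (l : ℕ) :
    (posSet n i l).Nonempty := by
  unfold posSet
  split_ifs <;> simp [hi, hin]

lemma add_arr_apply (A B : Arr) (p q : ℕ) : (A + B) p q = A p q + B p q := rfl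

lemma sub_arr_apply (A B : Arr) (p q : ℕ) : (A - B) p q = A p q - B p q := rfl

lemma pot_move_same {n i m l p t : ℕ} (hi : 1 ≤ i) (hin : i ≤ n) (A : Arr)
    (hp : p ∈ posSet n i l) (ht : t ∈ posSet n i l) :
    pot n i m l (A + move i l p) t = pot n i m l A t -
      (if key i l p ≤ key i l t then 1 else 0) - (if key i l p < key i l t then 1 else 0) := by
  rcases lt_trichotomy l i with h | rfl | h
  · rw [posSet_of_lt h, mem_Icc] at hp ht
    simp only [pot_of_lt h, move_of_lt h, key_of_lt h, add_arr_apply, sub_arr_apply,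
      sum_add_distrib, sum_sub_distrib, sum_unitArr_right]
    grind
  · rw [posSet_self, mem_singleton] at hp ht
    simp only [pot_self, move_self, add_arr_apply, sum_add_distrib, sum_unitArr_left,
      sum_unitArr_right, hp, ht]
    grind
  · rw [posSet_of_gt h, mem_Icc] at hp ht
    simp only [pot_of_gt h, move_of_gt h, key_of_ge h.le, add_arr_apply, sub_arr_apply,
      sum_add_distrib, sum_sub_distrib, sum_unitArr_left]
    grind

/-- Adjacent indices on the same side of `i`, the second one being further from `i`. -/
def Adjacent (i l j : ℕ) : Prop := (i ≤ l ∧ j = l + 1) ∨ (l ≤ i ∧ l = j + 1)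

/-- Nonadjacent indices which are not strictly separated by `i`. -/
def Far (i l j : ℕ) : Prop :=
  (l + 2 ≤ j ∨ j + 2 ≤ l) ∧ ((i ≤ l ∧ i ≤ j) ∨ (l ≤ i ∧ j ≤ i))

lemma pot_outer_move_inner {n i m l j p t : ℕ} (hi : 1 ≤ i) (hin : i ≤ n) (A : Arr)
    (h : Adjacent i l j) (hp : p ∈ posSet n i l) (ht : t ∈ posSet n i j) :
    pot n i m j (A + move i l p) t = pot n i m j A t +
      if key i j p ≤ key i j t then 1 else 0 := by
  rcases h with ⟨h, rfl⟩ | ⟨h, rfl⟩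
  · have hj : i < l + 1 := by omega
    rw [posSet_of_gt hj, mem_Icc] at ht
    rcases h.eq_or_lt with rfl | h
    · rw [posSet_self, mem_singleton] at hp
      simp only [pot_of_gt hj, move_self, key_of_ge hj.le, add_arr_apply,
        sum_add_distrib, sum_unitArr_left]
      grind
    · rw [posSet_of_gt h, mem_Icc] at hp
      simp only [pot_of_gt hj, move_of_gt h, key_of_ge hj.le, add_arr_apply, sub_arr_apply,
        sum_add_distrib, sum_sub_distrib, sum_unitArr_left]
      grind
  · have hj : j < i := by omega
    rw [posSet_of_lt hj, mem_Icc] at ht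
    rcases h.eq_or_lt with rfl | h
    · rw [posSet_self, mem_singleton] at hp
      simp only [pot_of_lt hj, move_self, key_of_lt hj, add_arr_apply,
        sum_add_distrib, sum_unitArr_right]
      grind
    · rw [posSet_of_lt h, mem_Icc] at hp
      simp only [pot_of_lt hj, move_of_lt h, key_of_lt hj, add_arr_apply, sub_arr_apply,
        sum_add_distrib, sum_sub_distrib, sum_unitArr_right]
      grind

lemma pot_inner_move_outer {n i m l j p t : ℕ} (hi : 1 ≤ i) (hin : i ≤ n) (A : Arr)
    (h : Adjacent i l j) (hjn : j ∈ Icc 1 n) (hp : p ∈ posSet n i j) (ht : t ∈ posSet n i l) :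
    pot n i m l (A + move i j p) t = pot n i m l A t +
      if key i j p < key i j t then 1 else 0 := by
  rw [mem_Icc] at hjn
  rcases h with ⟨h, rfl⟩ | ⟨h, rfl⟩
  · have hj : i < l + 1 := by omega
    rw [posSet_of_gt hj, mem_Icc] at hp
    rcases h.eq_or_lt with rfl | h
    · rw [posSet_self, mem_singleton] at ht
      simp only [pot_self, move_of_gt hj, key_of_ge hj.le, add_arr_apply, sub_arr_apply,
        sum_add_distrib, sum_sub_distrib, sum_unitArr_left, sum_unitArr_right]
      grind
    · rw [posSet_of_gt h, mem_Icc] at ht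
      simp only [pot_of_gt h, move_of_gt hj, key_of_ge hj.le, add_arr_apply, sub_arr_apply,
        sum_add_distrib, sum_sub_distrib, sum_unitArr_left]
      grind
  · have hj : j < i := by omega
    rw [posSet_of_lt hj, mem_Icc] at hp
    rcases h.eq_or_lt with rfl | h
    · rw [posSet_self, mem_singleton] at ht
      simp only [pot_self, move_of_lt hj, key_of_lt hj, add_arr_apply, sub_arr_apply,
        sum_add_distrib, sum_sub_distrib, sum_unitArr_left, sum_unitArr_right]
      grind
    · rw [posSet_of_lt h, mem_Icc] at ht
      simp only [pot_of_lt h, move_of_lt hj, key_of_lt hj, add_arr_apply, sub_arr_apply,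
        sum_add_distrib, sum_sub_distrib, sum_unitArr_right]
      grind

lemma pot_move_far {n i m l j p t : ℕ} (hi : 1 ≤ i) (hin : i ≤ n) (A : Arr)
    (h : Far i l j) (hl : l ∈ Icc 1 n) (hp : p ∈ posSet n i l) :
    pot n i m j (A + move i l p) t = pot n i m j A t := by
  rw [mem_Icc] at hl
  rcases lt_trichotomy j i with hj | rfl | hj
  · have hli : l ≤ i := by grind [Far]
    rcases hli.eq_or_lt with rfl | hli
    · simp only [pot_of_lt hj, move_self, add_arr_apply, sum_add_distrib, sum_unitArr_right]
      grind [Far]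
    · simp only [pot_of_lt hj, move_of_lt hli, add_arr_apply, sub_arr_apply,
        sum_add_distrib, sum_sub_distrib, sum_unitArr_right]
      grind [Far]
  · rcases lt_trichotomy l j with hlj | rfl | hlj
    · rw [posSet_of_lt hlj, mem_Icc] at hp
      simp only [pot_self, move_of_lt hlj, add_arr_apply, sub_arr_apply,
        sum_add_distrib, sum_sub_distrib, sum_unitArr_left, sum_unitArr_right]
      grind [Far]
    · grind [Far]
    · rw [posSet_of_gt hlj, mem_Icc] at hp
      simp only [pot_self, move_of_gt hlj, add_arr_apply, sub_arr_apply,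
        sum_add_distrib, sum_sub_distrib, sum_unitArr_left, sum_unitArr_right]
      grind [Far]
  · have hli : i ≤ l := by grind [Far]
    rcases hli.eq_or_lt with rfl | hli
    · simp only [pot_of_gt hj, move_self, add_arr_apply, sum_add_distrib, sum_unitArr_left]
      grind [Far]
    · simp only [pot_of_gt hj, move_of_gt hli, add_arr_apply, sub_arr_apply,
        sum_add_distrib, sum_sub_distrib, sum_unitArr_left]
      grind [Far]

lemma pot_move_of_gt_of_lt {n i m l j p t : ℕ} (A : Arr) (hl : i < l) (hj : j < i)
    (hln : l ≤ n) :
    pot n i m j (A + move i l p) t = pot n i m j A t +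
      (if p = j + 1 ∧ t = l then 1 else 0) - (if p = j ∧ t = l - 1 then 1 else 0) := by
  simp only [pot_of_lt hj, move_of_gt hl, add_arr_apply, sub_arr_apply,
    sum_add_distrib, sum_sub_distrib, sum_unitArr_right]
  grind

lemma pot_move_of_lt_of_gt {n i m l j p t : ℕ} (A : Arr) (hl : i < l) (hj : j < i)
    (hj1 : 1 ≤ j) (hp : p ∈ Icc 1 i) :
    pot n i m l (A + move i j t) p = pot n i m l A p +
      (if t = l - 1 ∧ p = j then 1 else 0) - (if t = l ∧ p = j + 1 then 1 else 0) := by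
  rw [mem_Icc] at hp
  simp only [pot_of_gt hl, move_of_lt hj, add_arr_apply, sub_arr_apply,
    sum_add_distrib, sum_sub_distrib, sum_unitArr_left]
  grind

lemma sum_Icc_eq_add_left (f : ℕ → ℤ) {a b : ℕ} (h : a ≤ b) :
    ∑ u ∈ Icc a b, f u = f a + ∑ u ∈ Icc (a + 1) b, f u := by
  rw [← Finset.add_sum_Ioc_eq_sum_Icc h, ← Finset.Icc_add_one_left_eq_Ioc]

lemma sum_Icc_eq_add_right (f : ℕ → ℤ) {a b : ℕ} (h : a ≤ b) (hb : 1 ≤ b) :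
    ∑ u ∈ Icc a b, f u = ∑ u ∈ Icc a (b - 1), f u + f b := by
  obtain ⟨c, rfl⟩ := Nat.exists_eq_add_of_le' hb
  rw [Finset.sum_Icc_succ_top (by omega)]
  rfl

lemma pot_sub_pot {n i m l j : ℕ} (A : Arr) (hl : i < l) (hj : j < i) (hln : l ≤ n)
    (hj1 : 1 ≤ j) :
    pot n i m l A (j + 1) - pot n i m l A j = pot n i m j A (l - 1) - pot n i m j A l := by
  simp only [pot_of_gt hl, pot_of_lt hj]
  have h1 := sum_Icc_eq_add_right (fun u => A u (l - 1)) (a := 1) (b := j + 1) (by omega)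
    (by omega)
  have h2 := sum_Icc_eq_add_right (fun u => A u l) (a := 1) (b := j) (by omega) (by omega)
  have h3 := sum_Icc_eq_add_left (fun u => A (j + 1) u) (a := l - 1) (b := n) (by omega)
  have h4 := sum_Icc_eq_add_left (fun u => A j u) (a := l) (b := n) (by omega)
  have e : l - 1 + 1 = l := by omega
  simp only [Nat.add_sub_cancel, e] at *
  omega

lemma weight_move_same {n i m l p : ℕ} (hi : 1 ≤ i) (hin : i ≤ n) (A : Arr)
    (hp : p ∈ posSet n i l) :
    weight n i m l (A + move i l p) = weight n i m l A - 2 := by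
  rcases lt_trichotomy l i with h | rfl | h
  · rw [posSet_of_lt h, mem_Icc] at hp
    simp only [weight_of_lt h, move_of_lt h, add_arr_apply, sub_arr_apply,
      sum_add_distrib, sum_sub_distrib, sum_unitArr_right]
    grind
  · simp only [weight_self, move_self, add_arr_apply, sum_add_distrib, sum_unitArr_left,
      sum_unitArr_right]
    simp only [unitArr]
    grind
  · rw [posSet_of_gt h, mem_Icc] at hp
    simp only [weight_of_gt h, move_of_gt h, add_arr_apply, sub_arr_apply,
      sum_add_distrib, sum_sub_distrib, sum_unitArr_left]
    grind

lemma weight_move {n i m l j p : ℕ} (hi : 1 ≤ i) (hin : i ≤ n) (A : Arr) (hjl : j ≠ l)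
    (hl : l ∈ Icc 1 n) (hj : j ∈ Icc 1 n) (hp : p ∈ posSet n i j) :
    weight n i m l (A + move i j p) =
      weight n i m l A + if j = l + 1 ∨ l = j + 1 then 1 else 0 := by
  rw [mem_Icc] at hl hj
  rcases lt_trichotomy j i with hji | hji | hji
  · rw [posSet_of_lt hji, mem_Icc] at hp
    rw [move_of_lt hji]
    rcases lt_trichotomy l i with h | h | h
    · simp only [weight_of_lt h, add_arr_apply, sub_arr_apply,
        sum_add_distrib, sum_sub_distrib, sum_unitArr_right]
      grind
    · subst h
      simp only [weight_self, add_arr_apply, sub_arr_apply, sum_add_distrib, sum_sub_distrib,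
        sum_unitArr_left, sum_unitArr_right]
      simp only [unitArr]
      grind
    · simp only [weight_of_gt h, add_arr_apply, sub_arr_apply,
        sum_add_distrib, sum_sub_distrib, sum_unitArr_left]
      grind
  · subst hji
    rw [move_self]
    rcases lt_trichotomy l j with h | h | h
    · simp only [weight_of_lt h, add_arr_apply, sum_add_distrib, sum_unitArr_right]
      grind
    · omega
    · simp only [weight_of_gt h, add_arr_apply, sum_add_distrib, sum_unitArr_left]
      grind
  · rw [posSet_of_gt hji, mem_Icc] at hp
    rw [move_of_gt hji]
    rcases lt_trichotomy l i with h | h | h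
    · simp only [weight_of_lt h, add_arr_apply, sub_arr_apply,
        sum_add_distrib, sum_sub_distrib, sum_unitArr_right]
      grind
    · subst h
      simp only [weight_self, add_arr_apply, sub_arr_apply, sum_add_distrib, sum_sub_distrib,
        sum_unitArr_left, sum_unitArr_right]
      simp only [unitArr]
      grind
    · simp only [weight_of_gt h, add_arr_apply, sub_arr_apply,
        sum_add_distrib, sum_sub_distrib, sum_unitArr_left]
      grind

/-- `f_l` acts on `A` at position `p`. -/
abbrev IsLowerPos (n i m l : ℕ) (A : Arr) (p : ℕ) : Prop :=
  IsFirstMax (key i l) (posSet n i l) (pot n i m l A) p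

/-- `e_l` acts on `A` at position `p`. -/
abbrev IsRaisePos (n i m l : ℕ) (A : Arr) (p : ℕ) : Prop :=
  IsFirstMax (fun t => -key i l t) (posSet n i l) (pot n i m l A) p

lemma sum_Icc_split (f : ℕ → ℤ) {a b c : ℕ} (hab : a ≤ b) (hbc : b ≤ c + 1) (hb : 1 ≤ b) :
    ∑ u ∈ Icc a c, f u = ∑ u ∈ Icc a (b - 1), f u + ∑ u ∈ Icc b c, f u := by
  have hd : Disjoint (Icc a (b - 1)) (Icc b c) := by
    rw [Finset.disjoint_left]
    intro x hx hy
    rw [mem_Icc] at hx hy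
    omega
  rw [← Finset.sum_union hd]
  congr 1
  ext x
  simp only [mem_Icc, mem_union]
  omega

lemma Fp_eq {i l t : ℕ} (h : i < l) (n m : ℕ) (A : Arr) (ht : t ∈ Icc 1 i) :
    Fp i A l t = pot n i m l A t + ∑ j ∈ Icc 1 i, A j l := by
  rw [mem_Icc] at ht
  have := sum_Icc_split (c := i) (fun j => A j l) ht.1 (by omega) ht.1
  rw [pot_of_gt h, Fp]
  linarith

lemma Fm_eq {n i l t : ℕ} (h : l < i) (m : ℕ) (A : Arr) (ht : t ∈ Icc i n) :
    Fm n i A l t = pot n i m l A t + ∑ j ∈ Icc i n, A l j := by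
  rw [mem_Icc] at ht
  have := sum_Icc_split (a := i) (b := t + 1) (c := n) (fun j => A l j) (by omega) (by omega)
    (by omega)
  rw [Nat.add_sub_cancel] at this
  rw [pot_of_lt h, Fm]
  linarith

lemma IsLowerPos.pplus_eq {n i m l p : ℕ} {A : Arr} (h : i < l) (hp : IsLowerPos n i m l A p) :
    pplus i A l = p := by
  obtain ⟨hmem, hle, hlt⟩ := hp
  simp only [posSet_of_gt h, key_of_ge h.le] at hmem hle hlt
  refine IsLeast.csInf_eq ⟨⟨hmem, fun q hq => ?_⟩, fun q hq => ?_⟩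
  · rw [Fp_eq h n m A hq, Fp_eq h n m A hmem]
    linarith [hle q hq]
  · by_contra hcon
    have h1 := hq.2 p hmem
    rw [Fp_eq h n m A hq.1, Fp_eq h n m A hmem] at h1
    have h2 := hlt q hq.1 (by omega)
    omega

lemma IsRaisePos.qplus_eq {n i m l p : ℕ} {A : Arr} (h : i < l) (hp : IsRaisePos n i m l A p) :
    qplus i A l = p := by
  obtain ⟨hmem, hle, hlt⟩ := hp
  simp only [posSet_of_gt h, key_of_ge h.le] at hmem hle hlt
  refine IsGreatest.csSup_eq ⟨⟨hmem, fun q hq => ?_⟩, fun q hq => ?_⟩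
  · rw [Fp_eq h n m A hq, Fp_eq h n m A hmem]
    linarith [hle q hq]
  · by_contra hcon
    have h1 := hq.2 p hmem
    rw [Fp_eq h n m A hq.1, Fp_eq h n m A hmem] at h1
    have h2 := hlt q hq.1 (by omega)
    omega

lemma IsLowerPos.pminus_eq {n i m l p : ℕ} {A : Arr} (h : l < i) (hp : IsLowerPos n i m l A p) :
    pminus n i A l = p := by
  obtain ⟨hmem, hle, hlt⟩ := hp
  simp only [posSet_of_lt h, key_of_lt h] at hmem hle hlt
  refine IsGreatest.csSup_eq ⟨⟨hmem, fun q hq => ?_⟩, fun q hq => ?_⟩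
  · rw [Fm_eq h m A hq, Fm_eq h m A hmem]
    linarith [hle q hq]
  · by_contra hcon
    have h1 := hq.2 p hmem
    rw [Fm_eq h m A hq.1, Fm_eq h m A hmem] at h1
    have h2 := hlt q hq.1 (by omega)
    omega

lemma IsRaisePos.qminus_eq {n i m l p : ℕ} {A : Arr} (h : l < i) (hp : IsRaisePos n i m l A p) :
    qminus n i A l = p := by
  obtain ⟨hmem, hle, hlt⟩ := hp
  simp only [posSet_of_lt h, key_of_lt h] at hmem hle hlt
  refine IsLeast.csInf_eq ⟨⟨hmem, fun q hq => ?_⟩, fun q hq => ?_⟩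
  · rw [Fm_eq h m A hq, Fm_eq h m A hmem]
    linarith [hle q hq]
  · by_contra hcon
    have h1 := hq.2 p hmem
    rw [Fm_eq h m A hq.1, Fm_eq h m A hmem] at h1
    have h2 := hlt q hq.1 (by omega)
    omega

lemma IsLowerPos.phi_eq {n i m l p : ℕ} {A : Arr} (hp : IsLowerPos n i m l A p) :
    phi n i m l A = pot n i m l A p := by
  rcases lt_trichotomy l i with h | rfl | h
  · rw [phi, if_neg h.ne, if_neg h.not_gt, hp.pminus_eq h, pot_of_lt h]
  · rw [phi, if_pos rfl, pot_self]
  · rw [phi, if_neg h.ne', if_pos h, hp.pplus_eq h, pot_of_gt h]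

lemma IsLowerPos.fop_eq {n i m l p : ℕ} {A : Arr} (hp : IsLowerPos n i m l A p)
    (h0 : pot n i m l A p ≠ 0) : fop n i m l A = some (A + move i l p) := by
  rw [fop, if_neg (by rwa [hp.phi_eq])]
  congr 1
  funext u v
  rcases lt_trichotomy l i with h | rfl | h
  · rw [if_neg h.ne, if_neg h.not_gt, hp.pminus_eq h, move_of_lt h]
    simp only [upd, add_arr_apply, sub_arr_apply, unitArr]
    grind
  · rw [if_pos rfl, move_self]
    simp only [upd, add_arr_apply, unitArr]
    grind
  · rw [if_neg h.ne', if_pos h, hp.pplus_eq h, move_of_gt h]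
    simp only [upd, add_arr_apply, sub_arr_apply, unitArr]
    grind

lemma IsRaisePos.eps_eq {n i m l p : ℕ} {A : Arr} (hp : IsRaisePos n i m l A p) :
    eps n i m l A = pot n i m l A p - weight n i m l A := by
  have hmem := hp.mem
  rcases lt_trichotomy l i with h | rfl | h
  · rw [posSet_of_lt h, mem_Icc] at hmem
    rw [eps, if_neg h.ne, if_neg h.not_gt, hp.qminus_eq h, pot_of_lt h, weight_of_lt h]
    have h1 := sum_Icc_split (fun j => A l j) (a := i) (b := p + 1) (c := n) (by omega) (by omega)
      (by omega)
    rcases Nat.eq_zero_or_pos p with rfl | hp0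
    · omega
    have h2 := sum_Icc_split (fun j => A (l + 1) j) (a := i) (b := p) (c := n) (by omega)
      (by omega) hp0
    simp only [Nat.add_sub_cancel] at h1 h2
    omega
  · rw [eps, if_pos rfl, pot_self, weight_self]
    ring
  · rw [posSet_of_gt h, mem_Icc] at hmem
    rw [eps, if_neg h.ne', if_pos h, hp.qplus_eq h, pot_of_gt h, weight_of_gt h]
    have h1 := sum_Icc_split (fun j => A j l) (a := 1) (b := p) (c := i) (by omega) (by omega)
      (by omega)
    have h2 := sum_Icc_split (fun j => A j (l - 1)) (a := 1) (b := p + 1) (c := i) (by omega)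
      (by omega) (by omega)
    simp only [Nat.add_sub_cancel] at h1 h2
    omega

lemma IsRaisePos.eop_eq {n i m l p : ℕ} {A : Arr} (hp : IsRaisePos n i m l A p)
    (h0 : eps n i m l A ≠ 0) : eop n i m l A = some (A - move i l p) := by
  rw [eop, if_neg h0]
  congr 1
  funext u v
  rcases lt_trichotomy l i with h | rfl | h
  · rw [if_neg h.ne, if_neg h.not_gt, hp.qminus_eq h, move_of_lt h]
    simp only [upd, sub_arr_apply, unitArr]
    grind
  · rw [if_pos rfl, move_self]
    simp only [upd, sub_arr_apply, unitArr]
    grind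
  · rw [if_neg h.ne', if_pos h, hp.qplus_eq h, move_of_gt h]
    simp only [upd, sub_arr_apply, unitArr]
    grind

lemma eps_eq_phi_sub_weight {n i m : ℕ} (hi : 1 ≤ i) (hin : i ≤ n) (l : ℕ) (A : Arr) :
    eps n i m l A = phi n i m l A - weight n i m l A := by
  have hne := posSet_nonempty hi hin l
  obtain ⟨p, hp⟩ := exists_isFirstMax (key i l) _ (pot n i m l A) hne
  obtain ⟨q, hq⟩ := exists_isFirstMax (fun t => -key i l t) _ (pot n i m l A) hne
  rw [IsRaisePos.eps_eq hq, IsLowerPos.phi_eq hp]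
  have := hp.le q hq.mem
  have := hq.le p hp.mem
  omega

lemma IsLowerPos.isRaisePos {n i m l p : ℕ} {A : Arr} (hi : 1 ≤ i) (hin : i ≤ n)
    (hp : IsLowerPos n i m l A p) : IsRaisePos n i m l (A + move i l p) p := by
  have hself := pot_move_same (m := m) hi hin A hp.mem hp.mem
  rw [if_pos le_rfl, if_neg (lt_irrefl _)] at hself
  refine ⟨hp.mem, fun t ht => ?_, fun t ht hlt => ?_⟩ <;>
  · have h1 := hp.le t ht
    have h2 := hp.lt t ht
    rw [pot_move_same hi hin A hp.mem ht, hself]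
    split_ifs <;> omega

lemma IsLowerPos.phi_move {n i m l p : ℕ} {A : Arr} (hi : 1 ≤ i) (hin : i ≤ n)
    (hp : IsLowerPos n i m l A p) :
    phi n i m l (A + move i l p) = phi n i m l A - 1 := by
  have hself := pot_move_same (m := m) hi hin A hp.mem hp.mem
  rw [if_pos le_rfl, if_neg (lt_irrefl _)] at hself
  have h1 := (hp.isRaisePos hi hin).eps_eq
  have h2 := eps_eq_phi_sub_weight (m := m) hi hin l (A + move i l p)
  rw [hp.phi_eq]
  omega

lemma eps_nonneg {n i m l : ℕ} {A : Arr} (hi : 1 ≤ i) (hin : i ≤ n) (hA : ∀ u v, 0 ≤ A u v) :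
    0 ≤ eps n i m l A := by
  obtain ⟨q, hq⟩ := exists_isFirstMax (fun t => -key i l t) _ (pot n i m l A)
    (posSet_nonempty hi hin l)
  have hle := hq.le
  rw [IsRaisePos.eps_eq hq]
  rcases lt_trichotomy l i with h | rfl | h
  · have h1 := hle i (by simp [posSet_of_lt h, hin])
    rw [pot_of_lt h] at h1
    rw [weight_of_lt h]
    have h2 := sum_Icc_eq_add_left (fun v => A l v) hin
    have h3 := hA l i
    omega
  · rw [pot_self, weight_self]
    linarith [hA l l]
  · have h1 := hle i (by simp [posSet_of_gt h, hi])
    rw [pot_of_gt h] at h1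
    rw [weight_of_gt h]
    have h2 := sum_Icc_eq_add_right (fun u => A u l) hi hi
    have h3 := hA i l
    omega

lemma IsLowerPos.eop_move {n i m l p : ℕ} {A : Arr} (hi : 1 ≤ i) (hin : i ≤ n)
    (hA : ∀ u v, 0 ≤ A u v) (hp : IsLowerPos n i m l A p) :
    eop n i m l (A + move i l p) = some A := by
  have h1 := eps_nonneg (m := m) (l := l) hi hin hA
  have h2 := hp.phi_move hi hin
  have h3 := weight_move_same (m := m) hi hin A hp.mem
  rw [eps_eq_phi_sub_weight hi hin] at h1
  rw [(hp.isRaisePos hi hin).eop_eq, add_sub_cancel_right]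
  rw [eps_eq_phi_sub_weight hi hin]
  omega

lemma IsLowerPos.move_nonneg {n i m l p : ℕ} {A : Arr} (hi : 1 ≤ i) (hin : i ≤ n)
    (hA : ∀ u v, 0 ≤ A u v) (hp : IsLowerPos n i m l A p) (h0 : pot n i m l A p ≠ 0)
    (u v : ℕ) : 0 ≤ (A + move i l p) u v := by
  have hmem := hp.mem
  have huv := hA u v
  rcases lt_trichotomy l i with h | rfl | h
  · rw [posSet_of_lt h, mem_Icc] at hmem
    have key_pos : 1 ≤ A (l + 1) p := by
      have h1 := sum_Icc_eq_add_left (fun v => A (l + 1) v) hmem.2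
      rcases hmem.2.eq_or_lt with rfl | hpn
      · rw [pot_of_lt h, h1] at h0
        simp only [Nat.lt_succ_self, Icc_eq_empty_of_lt, sum_empty] at h0
        have := hA (l + 1) p
        omega
      · have h2 := hp.lt (p + 1) (by rw [posSet_of_lt h, mem_Icc]; omega)
          (by simp only [key_of_lt h]; omega)
        have h3 := sum_Icc_eq_add_left (fun v => A l v) hpn
        rw [pot_of_lt h, pot_of_lt h] at h2
        have := hA l (p + 1)
        simp only [Nat.succ_eq_add_one] at h3
        omega
    simp only [move_of_lt h, add_arr_apply, sub_arr_apply, unitArr]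
    grind
  · simp only [move_self, add_arr_apply, unitArr]
    grind
  · rw [posSet_of_gt h, mem_Icc] at hmem
    have key_pos : 1 ≤ A p (l - 1) := by
      have h1 := sum_Icc_eq_add_right (fun u => A u (l - 1)) hmem.1 hmem.1
      rcases hmem.1.eq_or_lt with rfl | hpn
      · rw [pot_of_gt h, h1] at h0
        simp at h0
        have := hA 1 (l - 1)
        omega
      · have h2 := hp.lt (p - 1) (by rw [posSet_of_gt h, mem_Icc]; omega)
          (by simp only [key_of_ge h.le]; omega)
        have h3 := sum_Icc_eq_add_right (fun u => A u l) (a := 1) (b := p - 1) (by omega)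
          (by omega)
        rw [pot_of_gt h, pot_of_gt h] at h2
        have := hA (p - 1) l
        omega
    simp only [move_of_gt h, add_arr_apply, sub_arr_apply, unitArr]
    grind

lemma sum_hook_le {n i m : ℕ} {A : Arr} (hi : 1 ≤ i) (hin : i ≤ n) (hA : InB n i m A) :
    ∑ j ∈ Icc 1 (i - 1), A j i + ∑ j ∈ Icc i n, A i j ≤ m := by
  let γ : ℕ → ℕ × ℕ := fun s => if s < i then (s, i) else (i, s)
  have hL : IsDyck n i ((List.range' 1 n).map γ) := by
    refine ⟨?_, ?_, ?_, ?_⟩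
    · simp
      omega
    · rw [List.head?_map, List.head?_range', if_neg (by omega)]
      simp only [Option.map_some, γ]
      grind
    · rw [List.getLast?_map, List.getLast?_range', if_neg (by omega)]
      simp only [Option.map_some, γ]
      grind
    · change List.IsChain _ _
      rw [List.isChain_map]
      refine (List.isChain_range' 1 n 1).imp ?_
      intro a b hab
      simp only [γ]
      grind
  have h := hA.2.2 _ hL
  have hsum : ((List.range' 1 n).map (fun s => A (γ s).1 (γ s).2)).sum =
      ∑ s ∈ Icc 1 n, A (γ s).1 (γ s).2 := by
    rw [← List.sum_toFinset _ (List.nodup_range')]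
    congr 1
    ext x
    simp
    omega
  rw [List.map_map] at h
  have h' : ∑ s ∈ Icc 1 n, A (γ s).1 (γ s).2 ≤ m := hsum ▸ h
  rw [sum_Icc_split _ hi (by omega) hi] at h'
  convert h' using 2
  · refine sum_congr rfl fun x hx => ?_
    rw [mem_Icc] at hx
    simp only [γ]
    rw [if_pos (by omega)]
  · refine sum_congr rfl fun x hx => ?_
    rw [mem_Icc] at hx
    simp only [γ]
    rw [if_neg (by omega)]

lemma InB.nonneg {n i m : ℕ} {A : Arr} (hA : InB n i m A) (u v : ℕ) : 0 ≤ A u v := by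
  by_cases h : 1 ≤ u ∧ u ≤ i ∧ i ≤ v ∧ v ≤ n
  · exact hA.1 u v h.1 h.2.1 h.2.2.1 h.2.2.2
  · exact (hA.2.1 u v h).ge

lemma phi_nonneg {n i m : ℕ} {A : Arr} (hi : 1 ≤ i) (hin : i ≤ n) (hA : InB n i m A) (l : ℕ) :
    0 ≤ phi n i m l A := by
  obtain ⟨p, hp⟩ := exists_isFirstMax (key i l) _ (pot n i m l A) (posSet_nonempty hi hin l)
  rw [IsLowerPos.phi_eq hp]
  rcases lt_trichotomy l i with h | rfl | h
  · refine le_trans ?_ (hp.le n (by simp [posSet_of_lt h, hin]))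
    simpa [pot_of_lt h] using hA.nonneg (l + 1) n
  · rw [pot_self]
    linarith [sum_hook_le hi hin hA]
  · refine le_trans ?_ (hp.le 1 (by simp [posSet_of_gt h, hi]))
    simpa [pot_of_gt h] using hA.nonneg 1 (l - 1)

lemma Adjacent.key_le_key_iff {n i l j p t : ℕ} (h : Adjacent i l j) (hp : p ∈ posSet n i l)
    (ht : t ∈ posSet n i l) : key i j p ≤ key i j t ↔ key i l p ≤ key i l t := by
  rcases eq_or_ne l i with rfl | hli
  · rw [posSet_self, mem_singleton] at hp ht
    simp [hp, ht]
  · unfold Adjacent at h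
    unfold key
    split_ifs <;> omega

lemma Adjacent.key_lt_key_iff {n i l j p t : ℕ} (h : Adjacent i l j) (hp : p ∈ posSet n i l)
    (ht : t ∈ posSet n i l) : key i j p < key i j t ↔ key i l p < key i l t := by
  rw [← not_le, ← not_le, h.key_le_key_iff ht hp]

lemma Adjacent.isLowerPos_iff {n i m l j p : ℕ} {A : Arr} (h : Adjacent i l j) :
    IsLowerPos n i m l A p ↔ IsFirstMax (key i j) (posSet n i l) (pot n i m l A) p :=
  ⟨fun hp => ⟨hp.mem, hp.le, fun t ht hlt => hp.lt t ht ((h.key_lt_key_iff ht hp.mem).1 hlt)⟩,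
    fun hp => ⟨hp.mem, hp.le, fun t ht hlt => hp.lt t ht ((h.key_lt_key_iff ht hp.mem).2 hlt)⟩⟩

lemma pot_inner_move_same {n i m l j p t : ℕ} (hi : 1 ≤ i) (hin : i ≤ n) (A : Arr)
    (h : Adjacent i l j) (hp : p ∈ posSet n i l) (ht : t ∈ posSet n i l) :
    pot n i m l (A + move i l p) t = pot n i m l A t -
      (if key i j p ≤ key i j t then 1 else 0) - (if key i j p < key i j t then 1 else 0) := by
  rw [pot_move_same hi hin A hp ht]
  simp only [h.key_le_key_iff hp ht, h.key_lt_key_iff hp ht]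

lemma exists_isLowerPos {n i : ℕ} (hi : 1 ≤ i) (hin : i ≤ n) (m l : ℕ) (A : Arr) :
    ∃ p, IsLowerPos n i m l A p :=
  exists_isFirstMax _ _ _ (posSet_nonempty hi hin l)

/-- Two moves whose positions are compatible commute, and the `ε`-values agree. -/
lemma exists_commute {n i m l j p q p' q' : ℕ} {A : Arr} (hi : 1 ≤ i) (hin : i ≤ n)
    (hA : ∀ u v, 0 ≤ A u v) (hl : l ∈ Icc 1 n) (hj : j ∈ Icc 1 n) (hjl : j ≠ l)
    (hp : IsLowerPos n i m l A p) (hp0 : pot n i m l A p ≠ 0)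
    (hp' : IsLowerPos n i m l (A + move i j q) p')
    (hp'0 : pot n i m l (A + move i j q) p' ≠ 0)
    (hq' : IsLowerPos n i m j (A + move i l p) q')
    (hq'0 : pot n i m j (A + move i l p) q' ≠ 0)
    (hcomm : move i l p + move i j q' = move i j q + move i l p')
    (hval : pot n i m l (A + move i j q) p' =
      pot n i m l A p + if j = l + 1 ∨ l = j + 1 then 1 else 0) :
    ∃ A', fop n i m j (A + move i l p) = some A' ∧ fop n i m l (A + move i j q) = some A' ∧
      ∃ B, eop n i m j A' = some B ∧ eps n i m l A' = eps n i m l B := by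
  have hcomm' : A + move i l p + move i j q' = A + move i j q + move i l p' := by
    rw [add_assoc, hcomm, add_assoc]
  refine ⟨_, hq'.fop_eq hq'0, hcomm' ▸ hp'.fop_eq hp'0, _,
    hq'.eop_move hi hin (hp.move_nonneg hi hin hA hp0), ?_⟩
  rw [eps_eq_phi_sub_weight hi hin, eps_eq_phi_sub_weight hi hin,
    weight_move hi hin _ hjl hl hj hq'.mem, hcomm', hp'.phi_move hi hin, hp.phi_move hi hin,
    hp'.phi_eq, hp.phi_eq, hval]
  ring

lemma Far.symm {i l j : ℕ} (h : Far i l j) : Far i j l := by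
  unfold Far at *
  omega

lemma IsLowerPos.move_far {n i m l j p q : ℕ} {A : Arr} (hi : 1 ≤ i) (hin : i ≤ n)
    (h : Far i l j) (hl : l ∈ Icc 1 n) (hp : p ∈ posSet n i l) (hq : IsLowerPos n i m j A q) :
    IsLowerPos n i m j (A + move i l p) q := by
  have : pot n i m j (A + move i l p) = pot n i m j A :=
    funext fun t => pot_move_far hi hin A h hl hp
  rwa [IsLowerPos, this]

/-- Operators with indices on different sides of `i` commute; either the positions do not
change, or both are shifted by one. -/
lemma exists_positions_of_gt_of_lt {n i m l j p q : ℕ} {A : Arr} (hl : i < l) (hj : j < i)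
    (hln : l ≤ n) (hj1 : 1 ≤ j) (hp : IsLowerPos n i m l A p) (hq : IsLowerPos n i m j A q) :
    ∃ p' q', IsLowerPos n i m l (A + move i j q) p' ∧ IsLowerPos n i m j (A + move i l p) q' ∧
      pot n i m l (A + move i j q) p' = pot n i m l A p ∧
      pot n i m j (A + move i l p) q' = pot n i m j A q ∧
      move i l p + move i j q' = move i j q + move i l p' := by
  have hdiff := pot_sub_pot (n := n) (m := m) A hl hj hln hj1
  have hP : ∀ t ∈ Icc 1 i, _ := fun t ht =>
    pot_move_of_lt_of_gt (n := n) (m := m) (t := q) A hl hj hj1 ht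
  have hQ : ∀ t, _ := fun t => pot_move_of_gt_of_lt (m := m) (p := p) (t := t) A hl hj hln
  obtain ⟨hpm, hple, hplt⟩ := hp
  obtain ⟨hqm, hqle, hqlt⟩ := hq
  simp only [posSet_of_gt hl, key_of_ge hl.le] at hpm hple hplt
  simp only [posSet_of_lt hj, key_of_lt hj] at hqm hqle hqlt
  have hPj := hple j (by rw [mem_Icc]; omega)
  have hPj' := hplt j (by rw [mem_Icc]; omega)
  have hPj1 := hple (j + 1) (by rw [mem_Icc]; omega)
  have hPj1' := hplt (j + 1) (by rw [mem_Icc]; omega)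
  have hQl := hqle l (by rw [mem_Icc]; omega)
  have hQl' := hqlt l (by rw [mem_Icc]; omega)
  have hQl1 := hqle (l - 1) (by rw [mem_Icc]; omega)
  have hQl1' := hqlt (l - 1) (by rw [mem_Icc]; omega)
  by_cases hshift : p = j + 1 ∧ q = l - 1 ∧ pot n i m l A (j + 1) - pot n i m l A j = 1
  · obtain ⟨rfl, rfl, hone⟩ := hshift
    refine ⟨j, l, ⟨?_, fun t ht => ?_, fun t ht hlt => ?_⟩,
      ⟨?_, fun t ht => ?_, fun t ht hlt => ?_⟩, ?_, ?_, ?_⟩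
    all_goals try simp only [posSet_of_gt hl, key_of_ge hl.le, posSet_of_lt hj,
      key_of_lt hj] at *
    · rw [mem_Icc]; omega
    · have := hple t ht
      have hj' : j ∈ Icc 1 i := by rw [mem_Icc]; omega
      rw [hP t ht, hP j hj']
      grind
    · have := hplt t ht (by omega)
      have hj' : j ∈ Icc 1 i := by rw [mem_Icc]; omega
      rw [hP t ht, hP j hj']
      grind
    · rw [mem_Icc]; omega
    · have := hqle t ht
      rw [hQ t, hQ l]
      grind
    · have := hqlt t ht (by omega)
      rw [hQ t, hQ l]
      grind
    · have hj' : j ∈ Icc 1 i := by rw [mem_Icc]; omega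
      rw [hP j hj']
      grind
    · rw [hQ l]
      grind
    · rw [move_of_gt hl, move_of_gt hl, move_of_lt hj, move_of_lt hj]
      abel
  · have hPp : pot n i m l (A + move i j q) p = pot n i m l A p := by
      rw [hP p hpm]
      grind
    have hQq : pot n i m j (A + move i l p) q = pot n i m j A q := by
      rw [hQ q]
      grind
    refine ⟨p, q, ⟨?_, fun t ht => ?_, fun t ht hlt => ?_⟩,
      ⟨?_, fun t ht => ?_, fun t ht hlt => ?_⟩, hPp, hQq, add_comm _ _⟩
    all_goals try simp only [posSet_of_gt hl, key_of_ge hl.le, posSet_of_lt hj,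
      key_of_lt hj] at *
    · exact hpm
    · have := hple t ht
      rw [hPp, hP t ht]
      grind
    · have := hplt t ht hlt
      rw [hPp, hP t ht]
      grind
    · exact hqm
    · have := hqle t ht
      rw [hQq, hQ t]
      grind
    · have := hqlt t ht hlt
      rw [hQq, hQ t]
      grind

lemma exists_commute_of_phi_eq {n i m l j p q : ℕ} {A : Arr} (hi : 1 ≤ i) (hin : i ≤ n)
    (hA : InB n i m A) (hl : l ∈ Icc 1 n) (hj : j ∈ Icc 1 n) (hjl : j ≠ l)
    (hp : IsLowerPos n i m l A p) (hp0 : pot n i m l A p ≠ 0)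
    (hq : IsLowerPos n i m j A q) (hq0 : pot n i m j A q ≠ 0)
    (hphi : phi n i m j (A + move i l p) = phi n i m j A) :
    ∃ A', fop n i m j (A + move i l p) = some A' ∧ fop n i m l (A + move i j q) = some A' ∧
      ∃ B, eop n i m j A' = some B ∧ eps n i m l A' = eps n i m l B := by
  have hpos := phi_nonneg hi hin hA l
  rw [hp.phi_eq] at hpos
  obtain ⟨q₁, hq₁⟩ := exists_isLowerPos hi hin m j (A + move i l p)
  rw [hq₁.phi_eq, hq.phi_eq] at hphi
  have hlb := mem_Icc.1 hl
  have hjb := mem_Icc.1 hj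
  have hcases : Adjacent i l j ∨ Adjacent i j l ∨ Far i l j ∨ (i < l ∧ j < i) ∨
      (i < j ∧ l < i) := by
    unfold Adjacent Far
    omega
  rcases hcases with h | h | h | h | h
  · obtain ⟨hq', hqv, hp', hpv⟩ := isFirstMax_of_raise_ge (h.isLowerPos_iff.1 hp) hq hq₁
      (fun t ht => pot_outer_move_inner hi hin A h hp.mem ht)
      (fun t ht => pot_inner_move_outer hi hin A h hj hq.mem ht) hphi
    refine exists_commute hi hin hA.nonneg hl hj hjl hp hp0 (h.isLowerPos_iff.2 hp') (by omega)
      hq' (by omega) (add_comm _ _) ?_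
    rw [hpv, if_pos]
    unfold Adjacent at h
    omega
  · obtain ⟨hp', hpv, hq', hqv⟩ := isFirstMax_of_raise_gt (h.isLowerPos_iff.1 hq) hp
      (h.isLowerPos_iff.1 hq₁)
      (fun t ht => pot_outer_move_inner hi hin A h hq.mem ht)
      (fun t ht => pot_inner_move_outer hi hin A h hl hp.mem ht) hphi
    refine exists_commute hi hin hA.nonneg hl hj hjl hp hp0 hp' (by omega)
      (h.isLowerPos_iff.2 hq') (by omega) (add_comm _ _) ?_
    rw [hpv, if_pos]
    unfold Adjacent at h
    omega
  · have hp' := hp.move_far hi hin h.symm hj hq.mem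
    have hpv : pot n i m l (A + move i j q) p = pot n i m l A p :=
      pot_move_far hi hin A h.symm hj hq.mem
    have hqv : pot n i m j (A + move i l p) q = pot n i m j A q :=
      pot_move_far hi hin A h hl hp.mem
    refine exists_commute hi hin hA.nonneg hl hj hjl hp hp0 hp' (by omega)
      (hq.move_far hi hin h hl hp.mem) (by omega) (add_comm _ _) ?_
    rw [hpv, if_neg, add_zero]
    unfold Far at h
    omega
  · obtain ⟨p', q', hp', hq', hpv, hqv, hcomm⟩ :=
      exists_positions_of_gt_of_lt h.1 h.2 hlb.2 hjb.1 hp hq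
    refine exists_commute hi hin hA.nonneg hl hj hjl hp hp0 hp' (by omega) hq' (by omega)
      hcomm ?_
    rw [hpv, if_neg (by omega), add_zero]
  · obtain ⟨q', p', hq', hp', hqv, hpv, hcomm⟩ :=
      exists_positions_of_gt_of_lt h.1 h.2 hjb.2 hlb.1 hq hp
    refine exists_commute hi hin hA.nonneg hl hj hjl hp hp0 hp' (by omega) hq' (by omega)
      hcomm.symm ?_
    rw [hpv, if_neg (by omega), add_zero]

/-- If `f_j B = f_l C` with `φ_l(B) = φ_l(C) - 1` and `j`, `l` differ by one, then `e_j` raises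
`ε_l` of this element by one. -/
lemma exists_eop_eps_sub {n i m l j p q : ℕ} {B C : Arr} (hi : 1 ≤ i) (hin : i ≤ n)
    (hl : l ∈ Icc 1 n) (hj : j ∈ Icc 1 n) (hjl : j = l + 1 ∨ l = j + 1)
    (hB : ∀ u v, 0 ≤ B u v) (hq : IsLowerPos n i m j B q) (hp : IsLowerPos n i m l C p)
    (hBC : B + move i j q = C + move i l p) (hphi : phi n i m l B = phi n i m l C - 1) :
    ∃ D, eop n i m j (B + move i j q) = some D ∧
      eps n i m l (B + move i j q) - eps n i m l D = -1 := by
  refine ⟨B, hq.eop_move hi hin hB, ?_⟩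
  rw [eps_eq_phi_sub_weight hi hin, eps_eq_phi_sub_weight hi hin,
    weight_move hi hin _ (by omega) hl hj hq.mem, if_pos hjl, hBC, hp.phi_move hi hin, hphi]
  ring

lemma exists_quartic {n i m l j p q : ℕ} {A : Arr} (hi : 1 ≤ i) (hin : i ≤ n)
    (hA : InB n i m A) (hl : l ∈ Icc 1 n) (hj : j ∈ Icc 1 n) (h : Adjacent i l j)
    (hp : IsLowerPos n i m l A p) (hp0 : pot n i m l A p ≠ 0)
    (hq : IsLowerPos n i m j A q) (hq0 : pot n i m j A q ≠ 0)
    (hphij : phi n i m j (A + move i l p) = phi n i m j A + 1)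
    (hphil : phi n i m l (A + move i j q) = phi n i m l A + 1) :
    ∃ A', ((((fop n i m l A).bind (fop n i m j)).bind (fop n i m j)).bind (fop n i m l)
        = some A') ∧
      ((((fop n i m j A).bind (fop n i m l)).bind (fop n i m l)).bind (fop n i m j)
        = some A') ∧
      (∃ B, eop n i m j A' = some B ∧ eps n i m l A' - eps n i m l B = -1) ∧
      (∃ B, eop n i m l A' = some B ∧ eps n i m j A' - eps n i m j B = -1) := by
  have hposl := phi_nonneg hi hin hA l
  have hposj := phi_nonneg hi hin hA j
  have hadj : j = l + 1 ∨ l = j + 1 := by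
    unfold Adjacent at h
    omega
  obtain ⟨q₁, hq₁⟩ := exists_isLowerPos hi hin m j (A + move i l p)
  obtain ⟨q₂, hq₂⟩ := exists_isLowerPos hi hin m j (A + move i l p + move i j q₁)
  obtain ⟨p₃, hp₃⟩ :=
    exists_isLowerPos hi hin m l (A + move i l p + move i j q₁ + move i j q₂)
  obtain ⟨p₁, hp₁⟩ := exists_isLowerPos hi hin m l (A + move i j q)
  obtain ⟨p₂, hp₂⟩ := exists_isLowerPos hi hin m l (A + move i j q + move i l p₁)
  obtain ⟨q₃, hq₃⟩ :=
    exists_isLowerPos hi hin m j (A + move i j q + move i l p₁ + move i l p₂)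
  have hphij₁ := hq₁.phi_move hi hin
  have hphil₁ := hp₁.phi_move hi hin
  have hphij₂ := hq₂.phi_move hi hin
  have hphil₂ := hp₂.phi_move hi hin
  have el := hp.phi_eq
  have ej := hq.phi_eq
  have ej₁ := hq₁.phi_eq
  have el₁ := hp₁.phi_eq
  have ej₂ := hq₂.phi_eq
  have el₂ := hp₂.phi_eq
  have ej₃ := hq₃.phi_eq
  have el₃ := hp₃.phi_eq
  obtain ⟨⟨v₁, v₂, v₃, v₄⟩, hkeys⟩ := quartic_positions (h.isLowerPos_iff.1 hp) hq
    (h.isLowerPos_iff.1 hp₁) hq₁ (h.isLowerPos_iff.1 hp₂) hq₂ (h.isLowerPos_iff.1 hp₃) hq₃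
    (fun t ht => pot_inner_move_outer hi hin A h hj hq.mem ht)
    (fun t ht => pot_outer_move_inner hi hin A h hp.mem ht)
    (fun t ht => pot_inner_move_same hi hin _ h hp₁.mem ht)
    (fun t ht => pot_move_same hi hin _ hq₁.mem ht)
    (fun t ht => by
      rw [pot_inner_move_outer hi hin _ h hj hq₂.mem ht,
        pot_inner_move_outer hi hin _ h hj hq₁.mem ht,
        pot_inner_move_same hi hin _ h hp.mem ht])
    (fun t ht => by
      rw [pot_outer_move_inner hi hin _ h hp₂.mem ht,
        pot_outer_move_inner hi hin _ h hp₁.mem ht, pot_move_same hi hin _ hq.mem ht])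
    (by omega) (by omega)
  simp only [(key_injective i j).eq_iff] at hkeys
  have heq : A + move i j q + move i l p₁ + move i l p₂ + move i j q₃ =
      A + move i l p + move i j q₁ + move i j q₂ + move i l p₃ := by
    rcases hkeys with ⟨rfl, rfl, rfl, rfl⟩ | ⟨rfl, rfl, rfl, rfl⟩ <;> abel
  have hB := hp₂.move_nonneg hi hin (hp₁.move_nonneg hi hin
    (hq.move_nonneg hi hin hA.nonneg hq0) (by omega)) (by omega)
  have hC := hq₂.move_nonneg hi hin (hq₁.move_nonneg hi hin
    (hp.move_nonneg hi hin hA.nonneg hp0) (by omega)) (by omega)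
  refine ⟨A + move i j q + move i l p₁ + move i l p₂ + move i j q₃, ?_, ?_, ?_, ?_⟩
  · rw [heq, hp.fop_eq hp0, Option.bind_some, hq₁.fop_eq (by omega), Option.bind_some,
      hq₂.fop_eq (by omega), Option.bind_some, hp₃.fop_eq (by omega)]
  · rw [hq.fop_eq hq0, Option.bind_some, hp₁.fop_eq (by omega), Option.bind_some,
      hp₂.fop_eq (by omega), Option.bind_some, hq₃.fop_eq (by omega)]
  · exact exists_eop_eps_sub hi hin hl hj hadj hB hq₃ hp₃ heq (by omega)
  · rw [heq]
    exact exists_eop_eps_sub hi hin hj hl hadj.symm hC hp₃ hq₃ heq.symm (by omega)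

lemma phi_move_of_not_adjacent {n i m l j p : ℕ} {A : Arr} (hi : 1 ≤ i) (hin : i ≤ n)
    (hl : l ∈ Icc 1 n) (hj : j ∈ Icc 1 n) (hjl : j ≠ l) (h : ¬Adjacent i l j)
    (h' : ¬Adjacent i j l) (hp : IsLowerPos n i m l A p) :
    phi n i m j (A + move i l p) = phi n i m j A := by
  obtain ⟨q, hq⟩ := exists_isLowerPos hi hin m j A
  have hlb := mem_Icc.1 hl
  have hjb := mem_Icc.1 hj
  have hcases : Far i l j ∨ (i < l ∧ j < i) ∨ (i < j ∧ l < i) := by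
    unfold Adjacent at *
    unfold Far
    omega
  rcases hcases with h | h | h
  · rw [(hq.move_far hi hin h hl hp.mem).phi_eq, hq.phi_eq, pot_move_far hi hin A h hl hp.mem]
  · obtain ⟨_, q', _, hq', _, hqv, _⟩ :=
      exists_positions_of_gt_of_lt h.1 h.2 hlb.2 hjb.1 hp hq
    rw [hq'.phi_eq, hq.phi_eq, hqv]
  · obtain ⟨q', _, hq', _, hqv, _, _⟩ :=
      exists_positions_of_gt_of_lt h.1 h.2 hjb.2 hlb.1 hq hp
    rw [hq'.phi_eq, hq.phi_eq, hqv]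

/-- Dual Stembridge axioms for the lowering operators. -/
theorem stmt12 (n i m : ℕ) (hi : 1 ≤ i) (hin : i ≤ n) (A : Arr) (hA : InB n i m A)
    (l : ℕ) (hl : l ∈ Finset.Icc 1 n) (j : ℕ) (hj : j ∈ Finset.Icc 1 n) (hjl : j ≠ l)
    (Al Aj : Arr) (hAl : fop n i m l A = some Al) (hAj : fop n i m j A = some Aj) :
    (phi n i m j Al = phi n i m j A →
      ∃ A', fop n i m j Al = some A' ∧ fop n i m l Aj = some A' ∧
        ∃ B, eop n i m j A' = some B ∧ eps n i m l A' = eps n i m l B) ∧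
    (phi n i m j A - phi n i m j Al = -1 → phi n i m l A - phi n i m l Aj = -1 →
      ∃ A',
        ((((fop n i m l A).bind (fop n i m j)).bind (fop n i m j)).bind (fop n i m l)
            = some A') ∧
        ((((fop n i m j A).bind (fop n i m l)).bind (fop n i m l)).bind (fop n i m j)
            = some A') ∧
        (∃ B, eop n i m j A' = some B ∧ eps n i m l A' - eps n i m l B = -1) ∧
        (∃ B, eop n i m l A' = some B ∧ eps n i m j A' - eps n i m j B = -1)) := by
  obtain ⟨p, hp⟩ := exists_isLowerPos hi hin m l A
  obtain ⟨q, hq⟩ := exists_isLowerPos hi hin m j A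
  have hp0 : pot n i m l A p ≠ 0 := by
    intro h0
    simp [fop, hp.phi_eq, h0] at hAl
  have hq0 : pot n i m j A q ≠ 0 := by
    intro h0
    simp [fop, hq.phi_eq, h0] at hAj
  obtain rfl : A + move i l p = Al := Option.some_injective _ ((hp.fop_eq hp0).symm.trans hAl)
  obtain rfl : A + move i j q = Aj := Option.some_injective _ ((hq.fop_eq hq0).symm.trans hAj)
  refine ⟨exists_commute_of_phi_eq hi hin hA hl hj hjl hp hp0 hq hq0, fun hφj hφl => ?_⟩
  by_cases h : Adjacent i l j
  · exact exists_quartic hi hin hA hl hj h hp hp0 hq hq0 (by omega) (by omega)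
  by_cases h' : Adjacent i j l
  · obtain ⟨A', h₁, h₂, h₃, h₄⟩ :=
      exists_quartic hi hin hA hj hl h' hq hq0 hp hp0 (by omega) (by omega)
    exact ⟨A', h₂, h₁, h₄, h₃⟩
  · rw [phi_move_of_not_adjacent hi hin hl hj hjl h h' hp] at hφj
    omega

end KR
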